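/- Let k be a field, S = k[x₀,…,x_n] the polynomial ring in n+1 variables, f ∈ S a homogeneous polynomial of degree d > 0, q ≥ 1 an integer, and I = (x₀^q,…,x_n^q). Let a = max{ j : the degree-j homogeneous component of S/(I + (f)) is nonzero } and ι = min{ j : the degree-j homogeneous component of (I : f)/I is nonzero }. Then both quantities are well-defined (the relevant sets are nonempty and bounded) and a + ι = (n+1)(q−1). -/

import Mathlib

open MvPolynomial

section PowerIdeal

variable {σ k : Type*} [Field k] {q : ℕ}

theorem mem_span_X_pow_iff {g : MvPolynomial σ k} :
    g ∈ Ideal.span (Set.range fun i : σ => (X i : MvPolynomial σ k) ^ q) ↔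
      ∀ m ∈ g.support, ∃ i, q ≤ m i := by
  have h : (Set.range fun i : σ => (X i : MvPolynomial σ k) ^ q) =
      (fun s => monomial s (1 : k)) '' Set.range fun i : σ => Finsupp.single i q := by
    rw [← Set.range_comp]
    congr 1
    funext i
    simp [X_pow_eq_monomial]
  rw [h, mem_ideal_span_monomial_image]
  simp [Finsupp.single_le_iff]

variable [Fintype σ]

/-- The exponent of the socle monomial of `k[σ] / (X i ^ q)`. -/
noncomputable def socleExponent (σ : Type*) [Fintype σ] (q : ℕ) : σ →₀ ℕ :=
  Finsupp.equivFunOnFinite.symm fun _ => q - 1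

@[simp]
theorem socleExponent_apply (i : σ) : socleExponent σ q i = q - 1 := rfl

theorem degree_socleExponent : (socleExponent σ q).degree = Fintype.card σ * (q - 1) := by
  simp [Finsupp.degree_eq_sum]

theorem exists_le_iff_not_le_socleExponent (hq : 1 ≤ q) (m : σ →₀ ℕ) :
    (∃ i, q ≤ m i) ↔ ¬ m ≤ socleExponent σ q := by
  simp only [Finsupp.le_def, not_forall, socleExponent_apply]
  exact exists_congr fun i => by omega

theorem mem_span_X_pow_iff_not_le (hq : 1 ≤ q) {g : MvPolynomial σ k} :
    g ∈ Ideal.span (Set.range fun i : σ => (X i : MvPolynomial σ k) ^ q) ↔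
      ∀ m ∈ g.support, ¬ m ≤ socleExponent σ q := by
  simp only [mem_span_X_pow_iff, exists_le_iff_not_le_socleExponent hq]

theorem coeff_socleExponent_of_mem (hq : 1 ≤ q) {g : MvPolynomial σ k}
    (hg : g ∈ Ideal.span (Set.range fun i : σ => (X i : MvPolynomial σ k) ^ q)) :
    coeff (socleExponent σ q) g = 0 := by
  by_contra h
  exact (mem_span_X_pow_iff_not_le hq).1 hg _ (mem_support_iff.2 h) le_rfl

/-- A form outside `(X i ^ q)` pairs nontrivially with a monomial of complementary degree. -/
theorem exists_coeff_socleExponent_ne_zero (hq : 1 ≤ q) {g : MvPolynomial σ k} {i : ℕ}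
    (hg : g.IsHomogeneous i)
    (hgI : g ∉ Ideal.span (Set.range fun i : σ => (X i : MvPolynomial σ k) ^ q)) :
    i ≤ Fintype.card σ * (q - 1) ∧ ∃ h : MvPolynomial σ k,
      h.IsHomogeneous (Fintype.card σ * (q - 1) - i) ∧
        coeff (socleExponent σ q) (h * g) ≠ 0 := by
  rw [mem_span_X_pow_iff_not_le hq] at hgI
  push Not at hgI
  obtain ⟨m, hm, hle⟩ := hgI
  have hm' := mem_support_iff.1 hm
  have hdeg : m.degree = i := by
    rw [Finsupp.degree_eq_weight_one]
    exact hg hm'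
  have hadd : (socleExponent σ q - m).degree + m.degree = Fintype.card σ * (q - 1) := by
    rw [← map_add, tsub_add_cancel_of_le hle, degree_socleExponent]
  refine ⟨by omega, monomial (socleExponent σ q - m) 1,
    isHomogeneous_monomial _ (by omega), ?_⟩
  rw [coeff_monomial_mul', if_pos tsub_le_self, tsub_tsub_cancel_of_le hle, one_mul]
  exact hm'

/-- A linear functional vanishing on `(X i ^ q)` is represented on forms of degree `j` by
multiplication with a form of complementary degree. -/
theorem exists_coeff_socleExponent_eq (hq : 1 ≤ q) {j : ℕ} (l : MvPolynomial σ k →ₗ[k] k)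
    (hl : ∀ g ∈ Ideal.span (Set.range fun i : σ => (X i : MvPolynomial σ k) ^ q), l g = 0) :
    ∃ g : MvPolynomial σ k, g.IsHomogeneous (Fintype.card σ * (q - 1) - j) ∧
      ∀ h : MvPolynomial σ k, h.IsHomogeneous j →
        coeff (socleExponent σ q) (h * g) = l h := by
  classical
  set t := socleExponent σ q
  let s := (Finset.Iic t).filter fun m => m.degree = j
  refine ⟨∑ m ∈ s, monomial (t - m) (l (monomial m 1)), ?_, ?_⟩
  · refine IsHomogeneous.sum _ _ _ fun m hm => isHomogeneous_monomial _ ?_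
    obtain ⟨hle, hdeg⟩ := Finset.mem_filter.1 hm
    have hadd : (t - m).degree + m.degree = Fintype.card σ * (q - 1) := by
      rw [← map_add, tsub_add_cancel_of_le (Finset.mem_Iic.1 hle), degree_socleExponent]
    omega
  · intro h hh
    have hcoeff : coeff t (h * ∑ m ∈ s, monomial (t - m) (l (monomial m 1))) =
        ∑ m ∈ s, coeff m h * l (monomial m 1) := by
      rw [Finset.mul_sum, coeff_sum]
      refine Finset.sum_congr rfl fun m hm => ?_
      have hle := Finset.mem_Iic.1 (Finset.mem_filter.1 hm).1
      rw [coeff_mul_monomial', if_pos tsub_le_self, tsub_tsub_cancel_of_le hle]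
    have hlm (m : σ →₀ ℕ) : l (monomial m (coeff m h)) = coeff m h * l (monomial m 1) := by
      rw [← smul_eq_mul, ← map_smul, smul_monomial, smul_eq_mul, mul_one]
    rw [hcoeff]
    conv_rhs => rw [h.as_sum, map_sum]
    simp only [hlm]
    refine Finset.sum_congr_of_eq_on_inter ?_ ?_ fun _ _ _ => rfl
    · intro m _ hm
      rw [notMem_support_iff.1 hm, zero_mul]
    · intro m hm hms
      have hdeg : m.degree = j := by
        rw [Finsupp.degree_eq_weight_one]
        exact hh (mem_support_iff.1 hm)
      rw [hl, mul_zero]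
      rw [mem_span_X_pow_iff_not_le hq]
      intro m' hm' hle
      rw [support_monomial, if_neg one_ne_zero, Finset.mem_singleton] at hm'
      subst hm'
      exact hms (Finset.mem_filter.2 ⟨Finset.mem_Iic.2 hle, hdeg⟩)

/-- Macaulay duality between `S / (I + (f))` and `(I : f) / I` for `I = (X i ^ q)`. -/
theorem exists_isHomogeneous_mul_mem_iff (hq : 1 ≤ q) {d : ℕ} {f : MvPolynomial σ k}
    (hf : f.IsHomogeneous d) {I : Ideal (MvPolynomial σ k)}
    (hI : I = Ideal.span (Set.range fun i : σ => X i ^ q)) {i j : ℕ}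
    (hij : i + j = Fintype.card σ * (q - 1)) :
    (∃ g : MvPolynomial σ k, g.IsHomogeneous i ∧ g * f ∈ I ∧ g ∉ I) ↔
      ∃ h : MvPolynomial σ k, h.IsHomogeneous j ∧ h ∉ I + Ideal.span {f} := by
  subst hI
  constructor
  · rintro ⟨g, hg, hgf, hgI⟩
    obtain ⟨-, h, hh, hne⟩ := exists_coeff_socleExponent_ne_zero hq hg hgI
    refine ⟨h, by rwa [← hij, Nat.add_sub_cancel_left] at hh, fun hmem => hne ?_⟩
    obtain ⟨u, hu, w, hw, rfl⟩ := Submodule.mem_sup.1 hmem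
    obtain ⟨v, rfl⟩ := Ideal.mem_span_singleton'.1 hw
    refine coeff_socleExponent_of_mem hq ?_
    rw [show (u + v * f) * g = g * u + v * (g * f) by ring]
    exact add_mem (Ideal.mul_mem_left _ _ hu) (Ideal.mul_mem_left _ _ hgf)
  · rintro ⟨h, hh, hmem⟩
    obtain ⟨l, hlh, hl⟩ := Submodule.exists_le_ker_of_notMem (K := k)
      (p := (Ideal.span (Set.range fun i : σ => (X i : MvPolynomial σ k) ^ q) +
        Ideal.span {f}).restrictScalars k) hmem
    obtain ⟨g, hg, hgl⟩ := exists_coeff_socleExponent_eq hq (j := j) l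
      fun u hu => hl (Ideal.mem_sup_left hu)
    rw [← hij, Nat.add_sub_cancel] at hg
    refine ⟨g, hg, ?_, fun hgI => hlh ?_⟩
    · by_contra hgf
      obtain ⟨hle, v, hv, hne⟩ := exists_coeff_socleExponent_ne_zero hq (hg.mul hf) hgf
      refine hne ?_
      have hvf : (v * f).IsHomogeneous j := by
        convert hv.mul hf using 1
        omega
      rw [show v * (g * f) = v * f * g by ring, hgl _ hvf]
      exact hl (Ideal.mem_sup_right (Ideal.mul_mem_left _ _ (Ideal.mem_span_singleton_self f)))
    · rw [← hgl h hh]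
      exact coeff_socleExponent_of_mem hq (Ideal.mul_mem_left _ _ hgI)

end PowerIdeal

theorem map_quotient_mk_ne_bot_iff {k A : Type*} [CommRing k] [CommRing A] [Algebra k A]
    (J : Ideal A) (V : Submodule k A) :
    V.map (Ideal.Quotient.mkₐ k J).toLinearMap ≠ ⊥ ↔ ∃ h ∈ V, h ∉ J := by
  simp [Submodule.ne_bot_iff, Ideal.Quotient.eq_zero_iff_mem]

/-- **The socle degree of `S/(I+(f))` and the initial degree of `(I:f)/I` are
complementary.**  For `S = k[x₀,…,x_n]`, `f` homogeneous of degree `d > 0`, `q ≥ 1` and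
`I = (x₀^q,…,x_n^q)`, the largest degree `a` with nonzero component of `S/(I+(f))` and the
smallest degree `ι` with nonzero component of `(I:f)/I` exist, and
`a + ι = (n+1)(q−1)`. -/
theorem socle_degree_add_initial_degree
    (k : Type*) [Field k] (n : ℕ) (d : ℕ) (hd : 0 < d)
    (f : MvPolynomial (Fin (n + 1)) k) (hf : f.IsHomogeneous d)
    (q : ℕ) (hq : 1 ≤ q)
    (I : Ideal (MvPolynomial (Fin (n + 1)) k))
    (hI : I = Ideal.span (Set.range fun i : Fin (n + 1) => X i ^ q)) :
    ∃ a ι : ℕ,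
      IsGreatest {j : ℕ |
        (homogeneousSubmodule (Fin (n + 1)) k j).map
          (Ideal.Quotient.mkₐ k (I + Ideal.span {f})).toLinearMap ≠ ⊥} a ∧
      IsLeast {j : ℕ |
        ((homogeneousSubmodule (Fin (n + 1)) k j) ⊓
            Submodule.restrictScalars k (Submodule.colon I (Ideal.span {f}))).map
          (Ideal.Quotient.mkₐ k I).toLinearMap ≠ ⊥} ι ∧
      a + ι = (n + 1) * (q - 1) := by
  have hcard : Fintype.card (Fin (n + 1)) * (q - 1) = (n + 1) * (q - 1) := by simp
  set N := (n + 1) * (q - 1)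
  simp only [map_quotient_mk_ne_bot_iff, Submodule.mem_inf, mem_homogeneousSubmodule,
    Submodule.restrictScalars_mem]
  have hcolon (g : MvPolynomial (Fin (n + 1)) k) :
      g ∈ Submodule.colon I (Ideal.span {f} : Set (MvPolynomial (Fin (n + 1)) k)) ↔
        g * f ∈ I := by
    rw [Submodule.mem_colon]
    refine ⟨fun h => h f (Ideal.mem_span_singleton_self f), fun h p hp => ?_⟩
    obtain ⟨v, rfl⟩ := Ideal.mem_span_singleton'.1 hp
    rw [smul_eq_mul, mul_left_comm]
    exact Ideal.mul_mem_left _ _ h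
  simp only [hcolon, and_assoc]
  have hdual {i j : ℕ} (hij : i + j = N) :=
    exists_isHomogeneous_mul_mem_iff hq hf hI (hij.trans hcard.symm)
  have hle {j : ℕ} {h : MvPolynomial (Fin (n + 1)) k} (hh : h.IsHomogeneous j)
      (hhI : h ∉ I) : j ≤ N := by
    rw [← hcard]
    exact (exists_coeff_socleExponent_ne_zero hq hh (hI ▸ hhI)).1
  set s := {j : ℕ | ∃ h : MvPolynomial (Fin (n + 1)) k,
    h.IsHomogeneous j ∧ h ∉ I + Ideal.span {f}}
  have hbdd : N ∈ upperBounds s := fun j ⟨h, hh, hmem⟩ =>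
    hle hh fun hhI => hmem (Ideal.mem_sup_left hhI)
  have hzero : 0 ∈ s := by
    refine ⟨1, isHomogeneous_one _ _, fun hmem => ?_⟩
    have hker : I + Ideal.span {f} ≤
        RingHom.ker (constantCoeff : MvPolynomial (Fin (n + 1)) k →+* k) := by
      refine sup_le ?_ ?_
      · rw [hI, Ideal.span_le]
        rintro _ ⟨i, rfl⟩
        simp [RingHom.mem_ker, Nat.one_le_iff_ne_zero.1 hq]
      · rw [Ideal.span_singleton_le_iff_mem, RingHom.mem_ker, constantCoeff_eq]
        exact hf.coeff_eq_zero (by simpa using hd.ne)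
    simpa [RingHom.mem_ker] using hker hmem
  have hmax : IsGreatest s (sSup s) := ⟨Nat.sSup_mem ⟨0, hzero⟩ ⟨N, hbdd⟩,
    fun j hj => le_csSup ⟨N, hbdd⟩ hj⟩
  have haN : sSup s ≤ N := hbdd hmax.1
  refine ⟨sSup s, N - sSup s, hmax, ⟨(hdual (by omega)).2 hmax.1, ?_⟩, by omega⟩
  rintro i ⟨g, hg, hgf, hgI⟩
  have hiN := hle hg hgI
  have := hmax.2 ((hdual (i := i) (j := N - i) (by omega)).1 ⟨g, hg, hgf, hgI⟩)
  omega
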